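/- arXiv:1108.3539 — 3 statements merged into one kernel-verified Lean document; each statement's English description precedes it below -/
import Mathlib

section
/- For all odd positive integers N and f, the arithmetic function n ↦ c_{N,f}(n) is multiplicative: c_{N,f}(1) = 1 and c_{N,f}(mn) = c_{N,f}(m)·c_{N,f}(n) whenever gcd(m,n) = 1. -/
open scoped Classical BigOperators

noncomputable section

/-- the modulus ℓ^e with e = ν_ℓ(4nf²) -/
def CNlMod (n f ℓ : ℕ) : ℕ := ℓ ^ ((4 * n * f ^ 2).factorization ℓ)

/-- #C_N^{(ℓ)}(a,n,f): the number of z ∈ (ℤ/ℓ^eℤ)^*, e = ν_ℓ(4nf²),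
with D_N(z) ≡ af² (mod ℓ^e) -/
def CNl (N a n f ℓ : ℕ) : ℕ :=
  Nat.card {z : (ZMod (CNlMod n f ℓ))ˣ //
    ((z : ZMod (CNlMod n f ℓ))) ^ 2
        - 2 * ((N : ZMod (CNlMod n f ℓ)) + 1) * ((z : ZMod (CNlMod n f ℓ)))
        + ((N : ZMod (CNlMod n f ℓ)) - 1) ^ 2
      = (a : ZMod (CNlMod n f ℓ)) * (f : ZMod (CNlMod n f ℓ)) ^ 2}

/-- the odd part of n -/
def oddPart (n : ℕ) : ℕ := n / 2 ^ (n.factorization 2)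

/-- 𝒮₂(n,a) = 1 if n odd, 2 if n even and a ≡ 5 (8), 0 otherwise -/
def S2 (n a : ℕ) : ℤ := if Odd n then 1 else if a % 8 = 5 then 2 else 0

/-- c_{N,f}(n) = ∑_{a ∈ (ℤ/4nℤ)^*, a ≡ 1 (4)} (a/n')·𝒮₂(n,a)·∏_{ℓ ∣ n'} #C_N^{(ℓ)}(a,n,f),
where n' is the odd part of n -/
def cNf (N f n : ℕ) : ℤ :=
  ∑ a ∈ (Finset.range (4 * n)).filter (fun a => a % 4 = 1 ∧ a.Coprime (4 * n)),
    jacobiSym (a : ℤ) (oddPart n) * S2 n a *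
      ∏ ℓ ∈ (oddPart n).primeFactors, (CNl N a n f ℓ : ℤ)

theorem CNlMod_dvd (n f ℓ : ℕ) : CNlMod n f ℓ ∣ 4 * n * f ^ 2 :=
  Nat.ordProj_dvd _ _

theorem CNl_congr {N a b n f ℓ : ℕ} (h : a ≡ b [MOD 4 * n]) :
    CNl N a n f ℓ = CNl N b n f ℓ := by
  have key : (a : ZMod (CNlMod n f ℓ)) * (f : ZMod (CNlMod n f ℓ)) ^ 2
      = (b : ZMod (CNlMod n f ℓ)) * (f : ZMod (CNlMod n f ℓ)) ^ 2 := by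
    have h1 : a * f ^ 2 ≡ b * f ^ 2 [MOD CNlMod n f ℓ] :=
      (h.mul_right' (f ^ 2)).of_dvd (CNlMod_dvd n f ℓ)
    exact_mod_cast (ZMod.natCast_eq_natCast_iff _ _ _).2 h1
  unfold CNl
  rw [key]

theorem CNl_mul_left {N a m n f ℓ : ℕ} (hm : 0 < m) (hn : 0 < n) (hf : 0 < f) (h : ¬ ℓ ∣ n) :
    CNl N a (m * n) f ℓ = CNl N a m f ℓ := by
  have key : CNlMod (m * n) f ℓ = CNlMod m f ℓ := by
    have h1 : 4 * (m * n) * f ^ 2 = 4 * m * f ^ 2 * n := by ring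
    unfold CNlMod
    rw [h1, Nat.factorization_mul (by positivity) hn.ne', Finsupp.add_apply,
      Nat.factorization_eq_zero_of_not_dvd h, add_zero]
  unfold CNl
  rw [key]

theorem oddPart_dvd (n : ℕ) : oddPart n ∣ n := Nat.ordCompl_dvd n 2

theorem oddPart_mul (m n : ℕ) : oddPart (m * n) = oddPart m * oddPart n :=
  Nat.ordCompl_mul m n 2

theorem oddPart_pos {n : ℕ} (hn : 0 < n) : 0 < oddPart n := Nat.ordCompl_pos 2 hn.ne'

theorem S2_congr {n a b : ℕ} (h : a ≡ b [MOD 4 * n]) : S2 n a = S2 n b := by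
  unfold S2
  by_cases hn : Odd n
  · simp [hn]
  · obtain ⟨k, hk⟩ := Nat.not_odd_iff_even.1 hn
    have h8 : a % 8 = b % 8 := h.of_dvd ⟨k, by rw [hk]; ring⟩
    rw [h8]

theorem S2_mul {m n : ℕ} (h : m.Coprime n) (a : ℕ) : S2 (m * n) a = S2 m a * S2 n a := by
  unfold S2
  by_cases hm : Odd m
  · simp [Nat.odd_mul, hm]
  · have hn : Odd n := by
      by_contra hn
      exact Nat.not_coprime_of_dvd_of_dvd one_lt_two (Nat.not_odd_iff_even.1 hm).two_dvd
        (Nat.not_odd_iff_even.1 hn).two_dvd h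
    simp [Nat.odd_mul, hm, hn]

/-- The term of `cNf N f n` at `a`. -/
def cNfTerm (N f n a : ℕ) : ℤ :=
  jacobiSym (a : ℤ) (oddPart n) * S2 n a *
    ∏ ℓ ∈ (oddPart n).primeFactors, (CNl N a n f ℓ : ℤ)

theorem cNfTerm_congr {N f n a b : ℕ} (h : a ≡ b [MOD 4 * n]) :
    cNfTerm N f n a = cNfTerm N f n b := by
  have hJ : jacobiSym (a : ℤ) (oddPart n) = jacobiSym (b : ℤ) (oddPart n) := by
    apply jacobiSym.mod_left'
    exact_mod_cast h.of_dvd ((oddPart_dvd n).mul_left 4)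
  unfold cNfTerm
  rw [hJ, S2_congr h]
  simp only [CNl_congr h]

theorem cNfTerm_mul {N f m n : ℕ} (hf : 0 < f) (hm : 0 < m) (hn : 0 < n) (h : m.Coprime n)
    (a : ℕ) : cNfTerm N f (m * n) a = cNfTerm N f m a * cNfTerm N f n a := by
  have hc : (oddPart m).Coprime (oddPart n) :=
    h.of_dvd (oddPart_dvd m) (oddPart_dvd n)
  have aux : ∀ {m n : ℕ}, m.Coprime n → ∀ ℓ ∈ (oddPart m).primeFactors, ¬ ℓ ∣ n := by
    intro m n h ℓ hℓ hd
    exact Nat.not_coprime_of_dvd_of_dvd (Nat.prime_of_mem_primeFactors hℓ).one_lt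
      ((Nat.dvd_of_mem_primeFactors hℓ).trans (oddPart_dvd m)) hd h
  have h1 : ∏ ℓ ∈ (oddPart m).primeFactors, (CNl N a (m * n) f ℓ : ℤ)
      = ∏ ℓ ∈ (oddPart m).primeFactors, (CNl N a m f ℓ : ℤ) :=
    Finset.prod_congr rfl fun ℓ hℓ => by rw [CNl_mul_left hm hn hf (aux h ℓ hℓ)]
  have h2 : ∏ ℓ ∈ (oddPart n).primeFactors, (CNl N a (m * n) f ℓ : ℤ)
      = ∏ ℓ ∈ (oddPart n).primeFactors, (CNl N a n f ℓ : ℤ) :=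
    Finset.prod_congr rfl fun ℓ hℓ => by
      rw [mul_comm m n, CNl_mul_left hn hm hf (aux h.symm ℓ hℓ)]
  unfold cNfTerm
  rw [oddPart_mul, hc.primeFactors_mul, Finset.prod_union hc.disjoint_primeFactors, h1, h2,
    jacobiSym.mul_right' _ (oddPart_pos hm).ne' (oddPart_pos hn).ne', S2_mul h]
  ring

/-- The residues over which `cNf` sums. -/
def cNfIndex (n : ℕ) : Finset ℕ :=
  (Finset.range (4 * n)).filter (fun a => a % 4 = 1 ∧ a.Coprime (4 * n))

theorem cNf_eq_sum (N f n : ℕ) : cNf N f n = ∑ a ∈ cNfIndex n, cNfTerm N f n a := rfl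

theorem mem_cNfIndex {n a : ℕ} :
    a ∈ cNfIndex n ↔ a < 4 * n ∧ a % 4 = 1 ∧ a.Coprime (4 * n) := by
  simp [cNfIndex]

theorem mod_mem_cNfIndex {a k n : ℕ} (hn : 0 < n) (hnk : n ∣ k) (ha : a ∈ cNfIndex k) :
    a % (4 * n) ∈ cNfIndex n := by
  obtain ⟨-, h4, hc⟩ := mem_cNfIndex.1 ha
  refine mem_cNfIndex.2 ⟨Nat.mod_lt _ (by positivity), ?_, ?_⟩
  · rw [Nat.mod_mul_right_mod, h4]
  · have h1 : a.Coprime (4 * n) := hc.of_dvd_right (Nat.mul_dvd_mul_left 4 hnk)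
    exact (Nat.mod_modEq a (4 * n)).gcd_eq.trans h1

theorem gcd_four_mul {m n : ℕ} (h : m.Coprime n) : (4 * m).gcd (4 * n) = 4 := by
  rw [Nat.gcd_mul_left, h.gcd_eq_one, mul_one]

theorem lcm_four_mul {m n : ℕ} (h : m.Coprime n) : (4 * m).lcm (4 * n) = 4 * (m * n) := by
  rw [Nat.lcm_mul_left, h.lcm_eq_mul]

theorem cNf_mul {N f m n : ℕ} (hf : 0 < f) (hm : 0 < m) (hn : 0 < n) (h : m.Coprime n) :
    cNf N f (m * n) = cNf N f m * cNf N f n := by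
  rw [cNf_eq_sum, cNf_eq_sum, cNf_eq_sum, Finset.sum_mul_sum, ← Finset.sum_product']
  refine Finset.sum_bij (fun a _ => (a % (4 * m), a % (4 * n))) ?_ ?_ ?_ ?_
  · intro a ha
    exact Finset.mem_product.2 ⟨mod_mem_cNfIndex hm (Dvd.intro _ rfl) ha,
      mod_mem_cNfIndex hn (Dvd.intro_left _ rfl) ha⟩
  · intro a ha b hb hab
    obtain ⟨h1, h2⟩ := Prod.mk.inj hab
    have h3 : a ≡ b [MOD 4 * (m * n)] := by
      rw [← lcm_four_mul h]
      exact Nat.mod_lcm h1 h2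
    exact h3.eq_of_lt_of_lt (mem_cNfIndex.1 ha).1 (mem_cNfIndex.1 hb).1
  · rintro ⟨b, c⟩ hbc
    obtain ⟨hb, hc⟩ := Finset.mem_product.1 hbc
    obtain ⟨hb1, hb4, hbc⟩ := mem_cNfIndex.1 hb
    obtain ⟨hc1, hc4, hcc⟩ := mem_cNfIndex.1 hc
    have hmod : b ≡ c [MOD (4 * m).gcd (4 * n)] := by
      rw [gcd_four_mul h]
      exact hb4.trans hc4.symm
    obtain ⟨hkb, hkc⟩ := (Nat.chineseRemainder' hmod).2
    have hlt := Nat.chineseRemainder'_lt_lcm hmod (by positivity) (by positivity)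
    rw [lcm_four_mul h] at hlt
    set k : ℕ := (Nat.chineseRemainder' hmod : ℕ)
    have hkm : k.Coprime (4 * m) := hkb.gcd_eq.trans hbc
    have hkn : k.Coprime (4 * n) := hkc.gcd_eq.trans hcc
    refine ⟨k, mem_cNfIndex.2 ⟨hlt, ?_, ?_⟩, ?_⟩
    · exact Eq.trans (hkb.of_dvd (Dvd.intro _ rfl)) hb4
    · rw [← mul_assoc]
      exact hkm.mul_right hkn.coprime_mul_left_right
    · exact Prod.ext (Eq.trans hkb (Nat.mod_eq_of_lt hb1)) (Eq.trans hkc (Nat.mod_eq_of_lt hc1))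
  · intro a _
    rw [cNfTerm_mul hf hm hn h, cNfTerm_congr (Nat.mod_modEq a (4 * m)),
      cNfTerm_congr (Nat.mod_modEq a (4 * n))]

theorem cNf_one (N f : ℕ) : cNf N f 1 = 1 := by
  have h : cNfIndex 1 = {1} := by
    ext a
    rw [mem_cNfIndex, Finset.mem_singleton]
    constructor
    · omega
    · rintro rfl
      norm_num
  rw [cNf_eq_sum, h, Finset.sum_singleton]
  simp [cNfTerm, oddPart, S2]

/-- Lemma 4 (`compute factors of c`): the arithmetic function n ↦ c_{N,f}(n) is
multiplicative. -/
theorem cNf_multiplicative (N f : ℕ) (hN : Odd N) (hN0 : 0 < N) (hf : Odd f) (hf0 : 0 < f) :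
    cNf N f 1 = 1 ∧ ∀ m n : ℕ, 0 < m → 0 < n → m.Coprime n →
      cNf N f (m * n) = cNf N f m * cNf N f n :=
  ⟨cNf_one N f, fun _ _ hm hn h => cNf_mul hf0 hm hn h⟩
end
end

section
/- Let N and f be odd positive integers, α ≥ 1 an integer, and ℓ an odd prime with ℓ ∤ N and ℓ ∤ f. Then c_{N,f}(ℓ^α)/ℓ^{α−1} = ℓ − 1 − (N/ℓ) − ((N−1)/ℓ)² if α is even, and c_{N,f}(ℓ^α)/ℓ^{α−1} = −1 − ((N−1)/ℓ)² if α is odd, where (·/ℓ) is the Legendre symbol. -/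
open scoped Classical BigOperators

noncomputable section

section QuadraticCharSums

variable {F : Type*} [Field F] [Fintype F] [DecidableEq F]

theorem sum_comp_sq_eq_sum_quadraticChar (hF : ringChar F ≠ 2) (g : F → ℤ) :
    ∑ w : F, g (w ^ 2) = ∑ u : F, (quadraticChar F u + 1) * g u := by
  rw [← Finset.sum_fiberwise_of_maps_to (s := Finset.univ) (t := Finset.univ)
    (g := fun w : F => w ^ 2) (fun _ _ => Finset.mem_univ _)]
  refine Finset.sum_congr rfl fun u _ => ?_
  rw [← quadraticChar_card_sqrts hF u, Finset.sum_congr rfl (g := fun _ => g u), Finset.sum_const,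
    nsmul_eq_mul]
  · congr 3
    ext x
    simp
  · intro x hx
    rw [(Finset.mem_filter.1 hx).2]

theorem sum_quadraticChar_mul_sub (hF : ringChar F ≠ 2) {c : F} (hc : c ≠ 0) :
    ∑ u : F, quadraticChar F u * quadraticChar F (u - c) = -1 := by
  have hJ := jacobiSum_nontrivial_inv (quadraticChar_ne_one hF)
  rw [(quadraticChar_isQuadratic F).inv, jacobiSum] at hJ
  have hm : quadraticChar F (-1) * quadraticChar F (-1) = 1 := by
    rw [← sq, quadraticChar_sq_one (neg_ne_zero.2 one_ne_zero)]
  have hcc : quadraticChar F c * quadraticChar F c = 1 := by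
    rw [← sq, quadraticChar_sq_one hc]
  have key : ∀ x : F, quadraticChar F (c * x) * quadraticChar F (c * x - c) =
      quadraticChar F (-1) * (quadraticChar F x * quadraticChar F (1 - x)) := by
    intro x
    have : c * x - c = c * (-1 * (1 - x)) := by ring
    rw [this, map_mul, map_mul, map_mul]
    linear_combination (quadraticChar F x * quadraticChar F (-1) * quadraticChar F (1 - x)) * hcc
  rw [← Equiv.sum_comp (Equiv.mulLeft₀ c hc)]
  simp only [Equiv.mulLeft₀_apply, key]
  rw [← Finset.mul_sum, hJ]
  linear_combination -hm

theorem sum_quadraticChar_sq_sub (hF : ringChar F ≠ 2) {c : F} (hc : c ≠ 0) :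
    ∑ w : F, quadraticChar F (w ^ 2 - c) = -1 := by
  rw [sum_comp_sq_eq_sum_quadraticChar hF (fun u => quadraticChar F (u - c))]
  simp only [add_mul, one_mul, Finset.sum_add_distrib]
  have hshift : ∑ u : F, quadraticChar F (u - c) = 0 :=
    (Equiv.sum_comp (Equiv.subRight c) (quadraticChar F)).trans (quadraticChar_sum_zero hF)
  rw [sum_quadraticChar_mul_sub hF hc, hshift, add_zero]

theorem quadraticChar_pow_of_odd {k : ℕ} (hk : Odd k) (x : F) :
    quadraticChar F x ^ k = quadraticChar F x := by
  rcases quadraticChar_isQuadratic F x with h | h | h <;> rw [h]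
  · exact zero_pow hk.pos.ne'
  · exact one_pow k
  · exact hk.neg_one_pow

theorem quadraticChar_pow_of_even {k : ℕ} (hk : Even k) (hk0 : k ≠ 0) (x : F) :
    quadraticChar F x ^ k = if x = 0 then 0 else 1 := by
  split_ifs with hx
  · rw [hx, MulChar.map_zero, zero_pow hk0]
  · obtain ⟨m, rfl⟩ := hk
    rw [← two_mul, pow_mul, quadraticChar_sq_one hx, one_pow]

theorem sum_quadraticChar_sq_sub_pow_even (hF : ringChar F ≠ 2) {k : ℕ} (hk : Even k)
    (hk0 : k ≠ 0) (c : F) :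
    ∑ w : F, quadraticChar F (w ^ 2 - c) ^ k = Fintype.card F - 1 - quadraticChar F c := by
  rw [sum_comp_sq_eq_sum_quadraticChar hF (fun u => quadraticChar F (u - c) ^ k)]
  have key : ∀ u : F, (quadraticChar F u + 1) * quadraticChar F (u - c) ^ k =
      quadraticChar F u + 1 - if u = c then quadraticChar F u + 1 else 0 := by
    intro u
    simp only [quadraticChar_pow_of_even hk hk0, sub_eq_zero]
    split_ifs <;> ring
  simp only [key, Finset.sum_sub_distrib, Finset.sum_add_distrib, quadraticChar_sum_zero hF]
  simp
  ring

theorem sum_units_eq_sum_sub_zero {M : Type*} [AddCommGroup M] (h : F → M) :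
    ∑ u : Fˣ, h u = (∑ x : F, h x) - h 0 := by
  rw [eq_sub_iff_add_eq, ← Finset.sum_erase_add _ _ (Finset.mem_univ (0 : F))]
  congr 1
  refine Finset.sum_bij (fun u _ => (u : F)) ?_ ?_ ?_ ?_
  · intro u _
    simp
  · intro u _ v _ huv
    exact Units.ext huv
  · intro x hx
    exact ⟨Units.mk0 x (Finset.ne_of_mem_erase hx), Finset.mem_univ _, rfl⟩
  · intro u _
    rfl

theorem sum_units_quadraticChar_quadratic_pow (hF : ringChar F ≠ 2) {k : ℕ} (hk0 : k ≠ 0)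
    {m : F} (hm : m ≠ 0) :
    ∑ z : Fˣ, quadraticChar F ((z : F) ^ 2 - 2 * (m + 1) * z + (m - 1) ^ 2) ^ k =
      if Even k then (Fintype.card F : ℤ) - 1 - quadraticChar F m - quadraticChar F (m - 1) ^ 2
      else -1 - quadraticChar F (m - 1) ^ 2 := by
  have h2 : (2 : F) ≠ 0 := Ring.two_ne_zero hF
  have h4 : (2 : F) ^ 2 * m ≠ 0 := mul_ne_zero (pow_ne_zero _ h2) hm
  have hshift : ∑ z : F, quadraticChar F (z ^ 2 - 2 * (m + 1) * z + (m - 1) ^ 2) ^ k =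
      ∑ w : F, quadraticChar F (w ^ 2 - 2 ^ 2 * m) ^ k := by
    rw [← Equiv.sum_comp (Equiv.addRight (m + 1))]
    refine Finset.sum_congr rfl fun w _ => ?_
    congr 2
    simp only [Equiv.coe_addRight]
    ring
  rw [sum_units_eq_sum_sub_zero
    (fun z : F => quadraticChar F (z ^ 2 - 2 * (m + 1) * z + (m - 1) ^ 2) ^ k), hshift]
  have hzero : quadraticChar F ((0 : F) ^ 2 - 2 * (m + 1) * 0 + (m - 1) ^ 2) ^ k =
      quadraticChar F (m - 1) ^ 2 := by
    have : (0 : F) ^ 2 - 2 * (m + 1) * 0 + (m - 1) ^ 2 = (m - 1) ^ 2 := by ring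
    rw [this, map_pow]
    by_cases h : m - 1 = 0
    · simp [h, hk0]
    · rw [quadraticChar_sq_one h, one_pow]
  rw [hzero]
  split_ifs with hk
  · rw [sum_quadraticChar_sq_sub_pow_even hF hk hk0, map_mul, quadraticChar_sq_one' h2, one_mul]
  · simp only [quadraticChar_pow_of_odd (Nat.not_even_iff_odd.1 hk), sum_quadraticChar_sq_sub hF h4]

end QuadraticCharSums

theorem MonoidHom.sum_comp_of_surjective {G H M : Type*} [Group G] [Group H] [Fintype G]
    [Fintype H] [AddCommMonoid M] (φ : G →* H) (hφ : Function.Surjective φ) {d : ℕ}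
    (hd : Nat.card G = d * Nat.card H) (h : H → M) :
    ∑ g : G, h (φ g) = d • ∑ y : H, h y := by
  have hker : Nat.card φ.ker = d := by
    have h1 := φ.ker.card_mul_index
    rw [Subgroup.index_ker, Nat.card_congr (Equiv.subtypeUnivEquiv (p := (· ∈ φ.range))
      (fun y => hφ y)), hd] at h1
    exact Nat.eq_of_mul_eq_mul_right Nat.card_pos h1
  have hfib : ∀ y : H, (Finset.univ.filter fun g => φ g = y).card = d := by
    intro y
    rw [MonoidHom.card_fiber_eq_of_mem_range φ (hφ y) (hφ 1), ← hker, Nat.card_eq_fintype_card,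
      Fintype.card_subtype]
    simp only [MonoidHom.mem_ker]
  rw [← Finset.sum_fiberwise_of_maps_to (s := Finset.univ) (t := Finset.univ)
    (g := φ) (fun _ _ => Finset.mem_univ _), Finset.smul_sum]
  refine Finset.sum_congr rfl fun y _ => ?_
  rw [Finset.sum_congr rfl (g := fun _ => h y), Finset.sum_const, hfib]
  intro g hg
  rw [(Finset.mem_filter.1 hg).2]

theorem sum_units_castHom_prime_pow {ℓ k : ℕ} [Fact ℓ.Prime] (hk : k ≠ 0) (h : ZMod ℓ → ℤ) :
    ∑ z : (ZMod (ℓ ^ k))ˣ, h (ZMod.castHom (dvd_pow_self ℓ hk) (ZMod ℓ) z) =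
      (ℓ : ℤ) ^ (k - 1) * ∑ w : (ZMod ℓ)ˣ, h w := by
  have hp : ℓ.Prime := Fact.out
  have := MonoidHom.sum_comp_of_surjective (ZMod.unitsMap (dvd_pow_self ℓ hk))
    (ZMod.unitsMap_surjective _) (d := ℓ ^ (k - 1)) (by
      rw [Nat.card_eq_fintype_card, Nat.card_eq_fintype_card, ZMod.card_units_eq_totient,
        ZMod.card_units_eq_totient, Nat.totient_prime_pow hp (Nat.pos_of_ne_zero hk),
        Nat.totient_prime hp]) (fun w => h w)
  rw [nsmul_eq_mul, Nat.cast_pow] at this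
  exact this

theorem sum_range_four_mul_filter {q : ℕ} [NeZero q] (hq : Odd q) (g : ZMod q → ℤ) :
    ∑ a ∈ (Finset.range (4 * q)).filter (fun a => a % 4 = 1 ∧ a.Coprime (4 * q)), g a =
      ∑ b ∈ (Finset.univ : Finset (ZMod q)).filter IsUnit, g b := by
  have hcop : Nat.Coprime 4 q := by
    have := (Nat.coprime_two_left (n := q)).2 hq
    exact Nat.Coprime.pow_left 2 this
  have hfour : ∀ a : ℕ, a % 4 = 1 → Nat.Coprime a 4 := by
    intro a ha
    rw [Nat.coprime_iff_gcd_eq_one, Nat.gcd_comm, Nat.gcd_rec, ha]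
    rfl
  refine Finset.sum_bij (fun a _ => (a : ZMod q)) ?_ ?_ ?_ ?_
  · intro a ha
    simp only [Finset.mem_filter, Finset.mem_univ, true_and] at ha ⊢
    exact (ZMod.isUnit_iff_coprime a q).2 (Nat.Coprime.coprime_mul_left_right ha.2.2)
  · intro a ha b hb hab
    simp only [Finset.mem_filter, Finset.mem_range] at ha hb
    have h1 : a ≡ b [MOD q] := (ZMod.natCast_eq_natCast_iff a b q).1 hab
    have h2 : a ≡ b [MOD 4] := ha.2.1.trans hb.2.1.symm
    exact Nat.ModEq.eq_of_lt_of_lt ((Nat.modEq_and_modEq_iff_modEq_mul hcop).1 ⟨h2, h1⟩) ha.1 hb.1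
  · intro b hb
    simp only [Finset.mem_filter, Finset.mem_univ, true_and] at hb
    have hlt := Nat.chineseRemainder_lt_mul hcop 1 b.val (by norm_num) (NeZero.ne q)
    obtain ⟨h1, h2⟩ := (Nat.chineseRemainder hcop 1 b.val).2
    set a : ℕ := (Nat.chineseRemainder hcop 1 b.val).val
    have hab : (a : ZMod q) = b := by
      rw [(ZMod.natCast_eq_natCast_iff a b.val q).2 h2, ZMod.natCast_zmod_val]
    refine ⟨a, ?_, hab⟩
    simp only [Finset.mem_filter, Finset.mem_range]
    refine ⟨hlt, h1, Nat.Coprime.mul_right (hfour a h1) ?_⟩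
    rw [← ZMod.isUnit_iff_coprime, hab]
    exact hb
  · intro a _
    rfl

theorem CNlMod_prime_pow {f ℓ k : ℕ} (hℓ : ℓ.Prime) (hℓodd : Odd ℓ) (hf0 : 0 < f)
    (hℓf : ¬ ℓ ∣ f) : CNlMod (ℓ ^ k) f ℓ = ℓ ^ k := by
  have h4 : ¬ ℓ ∣ 4 := by
    intro h
    have h2 : ℓ ∣ 2 := hℓ.dvd_of_dvd_pow (show ℓ ∣ 2 ^ 2 from h)
    rw [(Nat.prime_dvd_prime_iff_eq hℓ Nat.prime_two).1 h2] at hℓodd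
    exact absurd hℓodd (by decide)
  have hpos := pow_pos hℓ.pos k
  rw [CNlMod, Nat.factorization_mul (by positivity) (by positivity),
    Nat.factorization_mul (by norm_num) hpos.ne', hℓ.factorization_pow]
  simp [Nat.factorization_eq_zero_of_not_dvd h4, Nat.factorization_eq_zero_of_not_dvd hℓf]

theorem jacobiSym_natCast_prime_pow {ℓ k : ℕ} [Fact ℓ.Prime] (hk : k ≠ 0) (a : ℕ) :
    jacobiSym a (ℓ ^ k) =
      quadraticChar (ZMod ℓ) (ZMod.castHom (dvd_pow_self ℓ hk) (ZMod ℓ) (a : ZMod (ℓ ^ k))) ^ k := by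
  rw [jacobiSym.pow_right, ← jacobiSym.legendreSym.to_jacobiSym, legendreSym, map_natCast,
    Int.cast_natCast]

theorem cNf_prime_pow_eq_sum {N f ℓ k : ℕ} [hp : Fact ℓ.Prime] (hk : k ≠ 0) (hℓodd : Odd ℓ)
    (hf0 : 0 < f) (hℓf : ¬ ℓ ∣ f) :
    cNf N f (ℓ ^ k) = ∑ z : (ZMod (ℓ ^ k))ˣ,
      quadraticChar (ZMod ℓ) (ZMod.castHom (dvd_pow_self ℓ hk) (ZMod ℓ)
        ((z : ZMod (ℓ ^ k)) ^ 2 - 2 * ((N : ZMod (ℓ ^ k)) + 1) * z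
          + ((N : ZMod (ℓ ^ k)) - 1) ^ 2)) ^ k := by
  have hodd : Odd (ℓ ^ k) := hℓodd.pow
  have hop : oddPart (ℓ ^ k) = ℓ ^ k := by
    rw [oddPart, Nat.factorization_eq_zero_of_not_dvd hodd.not_two_dvd_nat, pow_zero, Nat.div_one]
  have hmod : CNlMod (ℓ ^ k) f ℓ = ℓ ^ k := CNlMod_prime_pow hp.out hℓodd hf0 hℓf
  set π := ZMod.castHom (dvd_pow_self ℓ hk) (ZMod ℓ)
  set D : (ZMod (ℓ ^ k))ˣ → ZMod (ℓ ^ k) := fun z =>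
    (z : ZMod (ℓ ^ k)) ^ 2 - 2 * ((N : ZMod (ℓ ^ k)) + 1) * z + ((N : ZMod (ℓ ^ k)) - 1) ^ 2
  have hfu : IsUnit (f : ZMod (ℓ ^ k)) := (ZMod.isUnit_iff_coprime f (ℓ ^ k)).2
    (((Nat.Prime.coprime_iff_not_dvd hp.out).2 hℓf).symm.pow_right k)
  obtain ⟨v, hv⟩ := hfu
  have hcard : ∀ a : ℕ, (CNl N a (ℓ ^ k) f ℓ : ℤ) =
      ∑ z : (ZMod (ℓ ^ k))ˣ, if D z = (a : ZMod (ℓ ^ k)) * (f : ZMod (ℓ ^ k)) ^ 2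
        then 1 else 0 := by
    intro a
    rw [CNl, hmod, Nat.card_eq_fintype_card, Fintype.card_subtype, Finset.sum_boole]
  let G : ZMod (ℓ ^ k) → ℤ := fun b => quadraticChar (ZMod ℓ) (π b) ^ k *
    ∑ z : (ZMod (ℓ ^ k))ˣ, if D z = b * (f : ZMod (ℓ ^ k)) ^ 2 then 1 else 0
  have hG : cNf N f (ℓ ^ k) = ∑ b ∈ (Finset.univ : Finset (ZMod (ℓ ^ k))).filter IsUnit, G b := by
    rw [← sum_range_four_mul_filter hodd G, cNf]
    refine Finset.sum_congr rfl fun a _ => ?_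
    rw [hop, Nat.primeFactors_prime_pow hk hp.out, Finset.prod_singleton, S2, if_pos hodd, mul_one,
      jacobiSym_natCast_prime_pow hk, hcard]
  have hGuniv : ∑ b ∈ (Finset.univ : Finset (ZMod (ℓ ^ k))).filter IsUnit, G b = ∑ b, G b := by
    refine Finset.sum_filter_of_ne fun b _ hb => ?_
    by_contra hbu
    apply hb
    have : π b = 0 := by
      rw [← ZMod.natCast_zmod_val b] at hbu ⊢
      rw [ZMod.isUnit_iff_coprime, Nat.coprime_pow_right_iff (Nat.pos_of_ne_zero hk),
        Nat.coprime_comm, Nat.Prime.coprime_iff_not_dvd hp.out, not_not] at hbu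
      rw [map_natCast]
      exact (ZMod.natCast_eq_zero_iff _ _).2 hbu
    simp only [G, this, MulChar.map_zero, zero_pow hk, zero_mul]
  rw [hG, hGuniv]
  simp only [G, Finset.mul_sum]
  rw [Finset.sum_comm]
  refine Finset.sum_congr rfl fun z _ => ?_
  have hiff : ∀ b : ZMod (ℓ ^ k), D z = b * (f : ZMod (ℓ ^ k)) ^ 2 ↔
      b = D z * ((v⁻¹ ^ 2 : (ZMod (ℓ ^ k))ˣ) : ZMod (ℓ ^ k)) := by
    intro b
    rw [← hv, ← Units.val_pow_eq_pow_val, inv_pow, Units.eq_mul_inv_iff_mul_eq]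
    exact eq_comm
  simp only [hiff, mul_ite, mul_one, mul_zero, Finset.sum_ite_eq', Finset.mem_univ, if_true]
  rw [map_mul, map_mul, Units.val_pow_eq_pow_val, map_pow π, quadraticChar_sq_one', mul_one]
  exact ((v⁻¹).isUnit.map π).ne_zero

/-- Lemma 4 (`compute factors of c`): the value of c_{N,f}(ℓ^α) for an odd prime
ℓ ∤ Nf. -/
theorem cNf_ell_pow_not_dvd (N f ℓ α : ℕ) (hN : Odd N) (hN0 : 0 < N) (hf : Odd f)
    (hf0 : 0 < f) (hα : 1 ≤ α) (hℓ : ℓ.Prime) (hℓodd : Odd ℓ) (hℓN : ¬ ℓ ∣ N)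
    (hℓf : ¬ ℓ ∣ f) :
    cNf N f (ℓ ^ α) =
      (ℓ : ℤ) ^ (α - 1) *
        (if Even α then (ℓ : ℤ) - 1 - jacobiSym (N : ℤ) ℓ - (jacobiSym ((N : ℤ) - 1) ℓ) ^ 2
         else -1 - (jacobiSym ((N : ℤ) - 1) ℓ) ^ 2) := by
  have : Fact ℓ.Prime := ⟨hℓ⟩
  have hk : α ≠ 0 := Nat.one_le_iff_ne_zero.1 hα
  have hchar : ringChar (ZMod ℓ) ≠ 2 := by
    rw [ZMod.ringChar_zmod_n]
    rintro rfl
    exact absurd hℓodd (by decide)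
  have hm : (N : ZMod ℓ) ≠ 0 := fun h => hℓN ((ZMod.natCast_eq_zero_iff _ _).1 h)
  have hsum := sum_units_castHom_prime_pow hk (fun z : ZMod ℓ =>
    quadraticChar (ZMod ℓ) (z ^ 2 - 2 * ((N : ZMod ℓ) + 1) * z + ((N : ZMod ℓ) - 1) ^ 2) ^ α)
  rw [sum_units_quadraticChar_quadratic_pow hchar hk hm, ZMod.card] at hsum
  rw [cNf_prime_pow_eq_sum hk hℓodd hf0 hℓf, ← jacobiSym.legendreSym.to_jacobiSym,
    ← jacobiSym.legendreSym.to_jacobiSym, legendreSym, legendreSym]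
  push_cast
  rw [← hsum]
  refine Finset.sum_congr rfl fun z _ => ?_
  simp only [map_add, map_sub, map_mul, map_pow, map_natCast, map_one, map_ofNat]
end
end

section
/- Let N and f be odd positive integers, α ≥ 1 an integer, and ℓ an odd prime with ℓ | f and ℓ ∤ N. Then c_{N,f}(ℓ^α)/ℓ^{α−1} = #C_N^{(ℓ)}(1,1,f)·(ℓ−1) if α is even, and c_{N,f}(ℓ^α) = 0 if α is odd. -/
open scoped Classical BigOperators

noncomputable section

/-- The unit solutions of `D_N(z) = c` in a ring with a nilpotent-kernel surjection onto a field
correspond to those of `D_N(z) = 0` in the field, when `c` maps to `0` and `4N` does not. -/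
lemma card_units_solutions_eq {R K : Type*} [CommRing R] [Field K] (φ : R →+* K)
    (hφ : Function.Surjective φ) (hker : ∀ x, φ x = 0 → IsNilpotent x) (N : ℕ)
    (hN : (4 * N : K) ≠ 0) (c : R) (hc : φ c = 0) :
    Nat.card {z : Rˣ // (z : R) ^ 2 - 2 * ((N : R) + 1) * (z : R) + ((N : R) - 1) ^ 2 = c} =
    Nat.card {z : Kˣ // (z : K) ^ 2 - 2 * ((N : K) + 1) * (z : K) + ((N : K) - 1) ^ 2 = 0} := by
  have hφ2 : φ 2 = 2 := map_ofNat φ 2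
  have hnil : ∀ x, IsNilpotent x → φ x = 0 := fun x hx => (hx.map φ).eq_zero
  have hunit : ∀ x, φ x ≠ 0 → IsUnit x := by
    intro x hx
    obtain ⟨y, hy⟩ := hφ (φ x)⁻¹
    have h1 : IsNilpotent (x * y - 1) := hker _ (by simp [hy, hx])
    have h2 : IsUnit (x * y) := by simpa using h1.isUnit_add_one
    exact isUnit_of_mul_isUnit_left h2
  let P : Polynomial R := .X ^ 2 - .C (2 * ((N : R) + 1)) * .X + .C (((N : R) - 1) ^ 2 - c)
  have hP : ∀ x, Polynomial.aeval x P = x ^ 2 - 2 * ((N : R) + 1) * x + ((N : R) - 1) ^ 2 - c := by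
    intro x
    simp [P, add_sub_assoc]
  have hP' : ∀ x, Polynomial.aeval x (Polynomial.derivative P) = 2 * x - 2 * ((N : R) + 1) := by
    intro x
    have hd : Polynomial.derivative P = .C 2 * .X - .C (2 * ((N : R) + 1)) := by
      simp only [P, Polynomial.derivative_add, Polynomial.derivative_sub,
        Polynomial.derivative_X_sq, Polynomial.derivative_C_mul, Polynomial.derivative_X,
        Polynomial.derivative_C, mul_one, add_zero]
    simp [hd]
  have key : ∀ x, (φ x) ^ 2 - 2 * ((N : K) + 1) * φ x + ((N : K) - 1) ^ 2 = 0 →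
      ∃! r, IsNilpotent (x - r) ∧ r ^ 2 - 2 * ((N : R) + 1) * r + ((N : R) - 1) ^ 2 = c := by
    intro x hx
    have h := Polynomial.existsUnique_nilpotent_sub_and_aeval_eq_zero (P := P) (x := x)
      (by rw [hP]; apply hker; simpa [hc, hφ2] using hx)
      (by
        rw [hP']
        apply hunit
        intro h0
        apply hN
        simp only [map_sub, map_mul, map_add, map_ofNat, map_natCast, map_one] at h0
        have h2 : (2 : K) ≠ 0 := by
          intro h
          apply hN
          linear_combination (2 * (N : K)) * h
        have h3 : φ x = N + 1 := mul_left_cancel₀ h2 (sub_eq_zero.mp h0)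
        rw [h3] at hx
        linear_combination -hx)
    simpa only [hP, sub_eq_zero] using h
  have hmap : ∀ z : R, z ^ 2 - 2 * ((N : R) + 1) * z + ((N : R) - 1) ^ 2 = c →
      (φ z) ^ 2 - 2 * ((N : K) + 1) * φ z + ((N : K) - 1) ^ 2 = 0 := by
    intro z hz
    simpa [hc, hφ2] using congrArg φ hz
  refine Nat.card_congr (Equiv.ofBijective
    (fun z => ⟨Units.map φ.toMonoidHom z.1, hmap _ z.2⟩) ⟨?_, ?_⟩)
  · rintro ⟨z, hz⟩ ⟨w, hw⟩ h
    have h' : φ z = φ w := congrArg (fun t => ((Subtype.val t : Kˣ) : K)) h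
    apply Subtype.ext
    apply Units.ext
    exact (key z (hmap z hz)).unique ⟨by simp, hz⟩ ⟨hker _ (by simp [h']), hw⟩
  · rintro ⟨y, hy⟩
    obtain ⟨x, hx⟩ := hφ y
    obtain ⟨r, ⟨hr1, hr2⟩, -⟩ := key x (by rw [hx]; exact hy)
    have hr : φ r = y := by
      have := hnil _ hr1
      rw [map_sub, sub_eq_zero] at this
      rw [← this, hx]
    obtain ⟨u, hu⟩ := hunit r (by rw [hr]; exact y.ne_zero)
    refine ⟨⟨u, by rw [hu]; exact hr2⟩, ?_⟩
    apply Subtype.ext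
    apply Units.ext
    change φ u = y
    rw [hu, hr]

/-- `CNl` is computed in the residue field when `ℓ ∣ f`, `ℓ ∤ 2N`. -/
lemma CNl_eq_card_residue (N a n f ℓ : ℕ) [Fact ℓ.Prime] (hn : n ≠ 0) (hf0 : 0 < f)
    (hℓodd : Odd ℓ) (hℓf : ℓ ∣ f) (hℓN : ¬ ℓ ∣ N) :
    CNl N a n f ℓ = Nat.card {z : (ZMod ℓ)ˣ //
      (z : ZMod ℓ) ^ 2 - 2 * ((N : ZMod ℓ) + 1) * (z : ZMod ℓ) + ((N : ZMod ℓ) - 1) ^ 2 = 0} := by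
  have hℓ : ℓ.Prime := Fact.out
  have he : (4 * n * f ^ 2).factorization ℓ ≠ 0 := by
    rw [← Nat.pos_iff_ne_zero]
    exact hℓ.factorization_pos_of_dvd (by positivity)
      (Dvd.dvd.mul_left (dvd_pow hℓf two_ne_zero) _)
  unfold CNl
  have hdvd : ℓ ∣ CNlMod n f ℓ := dvd_pow_self ℓ he
  refine card_units_solutions_eq (ZMod.castHom hdvd (ZMod ℓ)) (ZMod.castHom_surjective hdvd)
    ?_ N ?_ _ ?_
  · intro x hx
    obtain ⟨k, rfl⟩ := ZMod.intCast_surjective x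
    rw [map_intCast, ZMod.intCast_zmod_eq_zero_iff_dvd] at hx
    obtain ⟨m, rfl⟩ := hx
    refine ⟨(4 * n * f ^ 2).factorization ℓ, ?_⟩
    rw [← Int.cast_pow, ZMod.intCast_zmod_eq_zero_iff_dvd, mul_pow, CNlMod, Nat.cast_pow]
    exact dvd_mul_right _ _
  · intro h
    have h' : ((2 ^ 2 * N : ℕ) : ZMod ℓ) = 0 := by push_cast; linear_combination h
    rw [ZMod.natCast_eq_zero_iff] at h'
    rcases hℓ.dvd_mul.mp h' with h2 | h2
    · have := (Nat.prime_dvd_prime_iff_eq hℓ Nat.prime_two).mp (hℓ.dvd_of_dvd_pow h2)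
      subst this
      exact absurd hℓodd (by decide)
    · exact hℓN h2
  · have : (f : ZMod ℓ) = 0 := (ZMod.natCast_eq_zero_iff _ _).mpr hℓf
    rw [map_mul, map_pow, map_natCast, map_natCast, this]
    simp

/-- Summing a character mod an odd `m` over the residues mod `4m` that are `1` mod `4` and coprime
to `4m` is the same as summing it over all residues mod `m`. -/
lemma sum_filter_mod_four_eq_sum_zmod {m : ℕ} [NeZero m] (hm : Odd m) (χ : MulChar (ZMod m) ℤ) :
    ∑ a ∈ (Finset.range (4 * m)).filter (fun a => a % 4 = 1 ∧ a.Coprime (4 * m)),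
      χ (a : ZMod m) = ∑ x : ZMod m, χ x := by
  have hm0 : 0 < m := Nat.pos_of_ne_zero (NeZero.ne m)
  have hcop : Nat.Coprime 4 m := by
    have : Nat.Coprime (2 ^ 2) m := Nat.Coprime.pow_left 2 (Nat.coprime_two_left.mpr hm)
    exact this
  have h1 : (Finset.range (4 * m)).filter (fun a => a % 4 = 1 ∧ a.Coprime (4 * m)) =
      ((Finset.range (4 * m)).filter (fun a => a % 4 = 1)).filter (fun a => a.Coprime m) := by
    ext a
    simp only [Finset.mem_filter, Nat.coprime_mul_iff_right]
    constructor
    · rintro ⟨h, h1, -, h2⟩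
      exact ⟨⟨h, h1⟩, h2⟩
    · rintro ⟨⟨h, h1⟩, h2⟩
      refine ⟨h, h1, ?_, h2⟩
      rw [Nat.coprime_iff_gcd_eq_one, Nat.gcd_comm, Nat.gcd_rec, h1]
      simp
  rw [h1, Finset.sum_filter_of_ne]
  · refine Finset.sum_nbij (fun a => (a : ZMod m)) (by simp) ?_ ?_ (by simp)
    · intro a ha b hb hab
      simp only [Finset.coe_filter, Finset.mem_range, Set.mem_ofPred_eq] at ha hb
      have h4 : a ≡ b [MOD 4] := ha.2.trans hb.2.symm
      have h5 : a ≡ b [MOD m] := (ZMod.natCast_eq_natCast_iff _ _ _).mp hab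
      exact Nat.ModEq.eq_of_lt_of_lt
        ((Nat.modEq_and_modEq_iff_modEq_mul hcop).mp ⟨h4, h5⟩) ha.1 hb.1
    · intro x _
      obtain ⟨k, hk1, hk2⟩ := Nat.chineseRemainder hcop 1 x.val
      refine ⟨k % (4 * m), ?_, ?_⟩
      · simp only [Finset.coe_filter, Finset.mem_range, Set.mem_ofPred_eq]
        refine ⟨Nat.mod_lt _ (by positivity), ?_⟩
        rw [Nat.mod_mul_right_mod]
        exact hk1
      · have : k % (4 * m) ≡ x.val [MOD m] :=
          ((Nat.mod_modEq k (4 * m)).of_mul_left 4).trans hk2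
        simpa using (ZMod.natCast_eq_natCast_iff _ _ _).mpr this
  · intro a _ ha
    by_contra hna
    exact ha (χ.map_nonunit (by rwa [ZMod.isUnit_iff_coprime]))

/-- The character sum of the Jacobi symbol modulo an odd prime power. -/
lemma sum_jacobiSym_prime_pow (ℓ α : ℕ) [Fact ℓ.Prime] (hα : α ≠ 0) (hℓodd : Odd ℓ) :
    ∑ a ∈ (Finset.range (4 * ℓ ^ α)).filter (fun a => a % 4 = 1 ∧ a.Coprime (4 * ℓ ^ α)),
      jacobiSym (a : ℤ) (ℓ ^ α) =
      if Even α then (ℓ : ℤ) ^ (α - 1) * ((ℓ : ℤ) - 1) else 0 := by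
  have hℓ : ℓ.Prime := Fact.out
  have : NeZero (ℓ ^ α) := ⟨pow_ne_zero _ hℓ.ne_zero⟩
  have hdvd : ℓ ∣ ℓ ^ α := dvd_pow_self ℓ hα
  let χ : DirichletCharacter ℤ (ℓ ^ α) :=
    DirichletCharacter.changeLevel hdvd (quadraticChar (ZMod ℓ) ^ α)
  have hχ : ∀ a : ℕ, a.Coprime (4 * ℓ ^ α) → jacobiSym (a : ℤ) (ℓ ^ α) = χ (a : ZMod (ℓ ^ α)) := by
    intro a ha
    have h2 : a.Coprime (ℓ ^ α) := (Nat.coprime_mul_iff_right.mp ha).2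
    have h3 := DirichletCharacter.changeLevel_eq_cast_of_dvd (quadraticChar (ZMod ℓ) ^ α) hdvd
      (ZMod.unitOfCoprime a h2)
    simp only [ZMod.coe_unitOfCoprime, ZMod.cast_natCast hdvd] at h3
    rw [jacobiSym.pow_right, ← jacobiSym.legendreSym.to_jacobiSym, legendreSym, h3, MulChar.pow_apply' _ hα]
    simp
  rw [Finset.sum_congr rfl fun a ha => hχ a (Finset.mem_filter.mp ha).2.2,
    sum_filter_mod_four_eq_sum_zmod hℓodd.pow]
  split_ifs with h
  · have : χ = 1 := by
      simp only [χ, (quadraticChar_isQuadratic (ZMod ℓ)).pow_even h, map_one]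
    rw [this, MulChar.sum_one_eq_card_units, ZMod.card_units_eq_totient,
      Nat.totient_prime_pow hℓ (Nat.pos_of_ne_zero hα)]
    push_cast [hℓ.one_le]
    rfl
  · apply MulChar.sum_eq_zero_of_ne_one
    simp only [χ, (quadraticChar_isQuadratic (ZMod ℓ)).pow_odd (Nat.not_even_iff_odd.mp h)]
    intro h1
    rw [DirichletCharacter.changeLevel_eq_one_iff] at h1
    refine quadraticChar_ne_one ?_ h1
    rw [ZMod.ringChar_zmod_n]
    rintro rfl
    exact absurd hℓodd (by decide)

/-- Lemma 4 (`compute factors of c`): the value of c_{N,f}(ℓ^α) for an odd prime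
ℓ ∣ f with ℓ ∤ N. -/
theorem cNf_ell_pow_dvd_f (N f ℓ α : ℕ) (hN : Odd N) (hN0 : 0 < N) (hf : Odd f)
    (hf0 : 0 < f) (hα : 1 ≤ α) (hℓ : ℓ.Prime) (hℓodd : Odd ℓ) (hℓf : ℓ ∣ f)
    (hℓN : ¬ ℓ ∣ N) :
    (Even α → cNf N f (ℓ ^ α) = (ℓ : ℤ) ^ (α - 1) * (CNl N 1 1 f ℓ : ℤ) * ((ℓ : ℤ) - 1)) ∧
    (Odd α → cNf N f (ℓ ^ α) = 0) := by
  have : Fact ℓ.Prime := ⟨hℓ⟩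
  have hα0 : α ≠ 0 := by omega
  have hodd : Odd (ℓ ^ α) := hℓodd.pow
  have hpart : oddPart (ℓ ^ α) = ℓ ^ α := by
    rw [oddPart, Nat.factorization_eq_zero_of_not_dvd hodd.not_two_dvd_nat]
    simp
  have hsum : cNf N f (ℓ ^ α) =
      (if Even α then (ℓ : ℤ) ^ (α - 1) * ((ℓ : ℤ) - 1) else 0) * (CNl N 1 1 f ℓ : ℤ) := by
    rw [cNf, ← sum_jacobiSym_prime_pow ℓ α hα0 hℓodd, Finset.sum_mul]
    refine Finset.sum_congr rfl fun a _ => ?_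
    rw [hpart, S2, if_pos hodd, Nat.primeFactors_prime_pow hα0 hℓ, Finset.prod_singleton,
      CNl_eq_card_residue N a _ f ℓ (pow_ne_zero _ hℓ.ne_zero) hf0 hℓodd hℓf hℓN,
      CNl_eq_card_residue N 1 1 f ℓ one_ne_zero hf0 hℓodd hℓf hℓN, mul_one]
  constructor
  · intro h
    rw [hsum, if_pos h]
    ring
  · intro h
    rw [hsum, if_neg (Nat.not_even_iff_odd.mpr h), zero_mul]
end
end
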